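/- arXiv:1405.2609 — 4 statements merged into one kernel-verified Lean document; each statement's English description precedes it below -/
import Mathlib

section
/- Let μ be a Borel probability measure on ℝ with μ((-∞,0)) = 0 and finite first moment, and let C_μ(K) = ∫ max(x − K, 0) dμ(x). If K ∈ ℝ satisfies μ({K}) = 0, then C_μ is differentiable at K with derivative C_μ'(K) = −μ((K, ∞)) (the tail probability taken as a real number). -/
open MeasureTheory

/-- The call payoff is differentiable in the strike away from the asset price. -/
theorem hasDerivAt_max_sub_zero {x K : ℝ} (h : x ≠ K) :
    HasDerivAt (fun k : ℝ => max (x - k) 0) ((Set.Ioi K).indicator (fun _ => (-1 : ℝ)) x) K := by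
  rcases lt_or_gt_of_ne h with h | h
  · rw [Set.indicator_of_notMem (by simpa using h.le)]
    refine (hasDerivAt_const K (0 : ℝ)).congr_of_eventuallyEq ?_
    filter_upwards [lt_mem_nhds h] with k hk
    exact max_eq_right (by linarith)
  · rw [Set.indicator_of_mem (by simpa using h)]
    refine ((hasDerivAt_id K).const_sub x).congr_of_eventuallyEq ?_
    filter_upwards [gt_mem_nhds h] with k hk
    exact max_eq_left (by simpa using hk.le)

/-- The call payoff is `1`-Lipschitz in the strike. -/
theorem lipschitzWith_max_sub_zero (x : ℝ) : LipschitzWith 1 fun k : ℝ => max (x - k) 0 := by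
  refine LipschitzWith.max_const (LipschitzWith.of_dist_le_mul fun a b => ?_) 0
  rw [NNReal.coe_one, one_mul, dist_sub_left]

/-- If `μ({K}) = 0` then the call price is differentiable at `K` with derivative
`−μ((K, ∞))`. -/
theorem call_price_hasDerivAt (μ : Measure ℝ) [IsProbabilityMeasure μ]
    (h0 : μ (Set.Iio 0) = 0) (hmom : Integrable (fun x : ℝ => x) μ)
    (K : ℝ) (hK : μ {K} = 0) :
    HasDerivAt (fun K : ℝ => ∫ x, max (x - K) 0 ∂μ) (-(μ (Set.Ioi K)).toReal) K := by
  have hint : ∀ k : ℝ, Integrable (fun x : ℝ => max (x - k) 0) μ := fun k =>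
    (hmom.sub (integrable_const k)).pos_part
  have hne : ∀ᵐ x ∂μ, x ≠ K := by
    rw [ae_iff]
    simpa using hK
  have key := (hasDerivAt_integral_of_dominated_loc_of_lip (μ := μ) (𝕜 := ℝ)
    (F := fun k x : ℝ => max (x - k) 0) (bound := fun _ => (1 : ℝ)) Filter.univ_mem
    (.of_forall fun k => (hint k).aestronglyMeasurable) (hint K)
    (F' := (Set.Ioi K).indicator fun _ => (-1 : ℝ))
    (aestronglyMeasurable_const.indicator measurableSet_Ioi)
    (.of_forall fun x => by simpa using lipschitzWith_max_sub_zero x)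
    (integrable_const 1) (hne.mono fun x hx => hasDerivAt_max_sub_zero hx)).2
  rw [integral_indicator_const _ measurableSet_Ioi] at key
  simpa [Measure.real] using key
end

section
/- (Uniqueness of the call-pricing measure.) Let μ₁ and μ₂ be Borel probability measures on ℝ with μ₁((-∞,0)) = μ₂((-∞,0)) = 0, each with finite first moment. If the call prices agree at every strike, i.e. ∫ max(x − K, 0) dμ₁(x) = ∫ max(x − K, 0) dμ₂(x) for all K ≥ 0, then μ₁ = μ₂. -/
open MeasureTheory

lemma integrable_call_payoff {μ : Measure ℝ} [IsFiniteMeasure μ]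
    (hm : Integrable (fun x : ℝ => x) μ) (K : ℝ) :
    Integrable (fun x : ℝ => max (x - K) 0) μ :=
  (hm.sub (integrable_const K)).pos_part

/-- The right difference quotients of the call price converge to the tail probability. -/
lemma tendsto_call_spread {μ : Measure ℝ} [IsFiniteMeasure μ]
    (hm : Integrable (fun x : ℝ => x) μ) (K : ℝ) :
    Filter.Tendsto
      (fun n : ℕ => ((n : ℝ) + 1) *
        ((∫ x, max (x - K) 0 ∂μ) - ∫ x, max (x - (K + 1 / ((n : ℝ) + 1))) 0 ∂μ))
      Filter.atTop (nhds (μ.real (Set.Ioi K))) := by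
  have key : Filter.Tendsto
      (fun n : ℕ => ∫ x, ((n : ℝ) + 1) *
        (max (x - K) 0 - max (x - (K + 1 / ((n : ℝ) + 1))) 0) ∂μ)
      Filter.atTop (nhds (∫ x, (Set.Ioi K).indicator (fun _ => (1 : ℝ)) x ∂μ)) := by
    refine tendsto_integral_of_dominated_convergence (fun _ => (1 : ℝ)) (fun n => ?_)
      (integrable_const 1) (fun n => ?_) ?_
    · fun_prop
    · refine Filter.Eventually.of_forall fun x => ?_
      have hn : (0 : ℝ) < (n : ℝ) + 1 := by positivity
      have hh : (0 : ℝ) < 1 / ((n : ℝ) + 1) := by positivity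
      have h_mul : ((n : ℝ) + 1) * (1 / ((n : ℝ) + 1)) = 1 := mul_one_div_cancel hn.ne'
      have h_nonneg : 0 ≤ max (x - K) 0 - max (x - (K + 1 / ((n : ℝ) + 1))) 0 :=
        sub_nonneg.2 (max_le_max (by linarith) le_rfl)
      have h_le : max (x - K) 0 - max (x - (K + 1 / ((n : ℝ) + 1))) 0
          ≤ 1 / ((n : ℝ) + 1) := by
        rw [sub_le_iff_le_add]
        refine max_le ?_ (add_nonneg hh.le (le_max_right _ _))
        linarith [le_max_left (x - (K + 1 / ((n : ℝ) + 1))) 0]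
      rw [Real.norm_of_nonneg (mul_nonneg hn.le h_nonneg)]
      exact (mul_le_mul_of_nonneg_left h_le hn.le).trans_eq h_mul
    · refine Filter.Eventually.of_forall fun x => ?_
      refine tendsto_const_nhds.congr' ?_
      rcases le_or_gt x K with hx | hx
      · refine Filter.Eventually.of_forall fun n => ?_
        have hh : (0 : ℝ) < 1 / ((n : ℝ) + 1) := by positivity
        beta_reduce
        rw [Set.indicator_of_notMem (by simpa using hx),
          max_eq_right (a := x - K) (by linarith),
          max_eq_right (a := x - (K + 1 / ((n : ℝ) + 1))) (by linarith), sub_self, mul_zero]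
      · filter_upwards [(tendsto_one_div_add_atTop_nhds_zero_nat (𝕜 := ℝ)).eventually_lt_const
          (sub_pos.2 hx)] with n hn
        rw [Set.indicator_of_mem (Set.mem_Ioi.2 hx),
          max_eq_left (a := x - K) (by linarith),
          max_eq_left (a := x - (K + 1 / ((n : ℝ) + 1))) (by linarith)]
        field_simp
        ring
  rw [integral_indicator_const _ measurableSet_Ioi, smul_eq_mul, mul_one] at key
  refine key.congr fun n => ?_
  rw [integral_const_mul,
    integral_sub (integrable_call_payoff hm _) (integrable_call_payoff hm _)]

/-- Uniqueness of the call-pricing measure: if two nonnegative-supported probability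
measures with finite first moment give the same call prices at every strike `K ≥ 0`,
they are equal. -/
theorem call_pricing_measure_unique (μ₁ μ₂ : Measure ℝ)
    [IsProbabilityMeasure μ₁] [IsProbabilityMeasure μ₂]
    (h1 : μ₁ (Set.Iio 0) = 0) (h2 : μ₂ (Set.Iio 0) = 0)
    (hm1 : Integrable (fun x : ℝ => x) μ₁) (hm2 : Integrable (fun x : ℝ => x) μ₂)
    (hcall : ∀ K : ℝ, 0 ≤ K →
      (∫ x, max (x - K) 0 ∂μ₁) = ∫ x, max (x - K) 0 ∂μ₂) :
    μ₁ = μ₂ := by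
  refine Measure.ext_of_Iic μ₁ μ₂ fun a => ?_
  rcases lt_or_ge a 0 with ha | ha
  · have h_sub : Set.Iic a ⊆ Set.Iio 0 := Set.Iic_subset_Iio.2 ha
    rw [measure_mono_null h_sub h1, measure_mono_null h_sub h2]
  · have h_tail : μ₁.real (Set.Ioi a) = μ₂.real (Set.Ioi a) := by
      refine tendsto_nhds_unique (tendsto_call_spread hm1 a)
        ((tendsto_call_spread hm2 a).congr fun n => ?_)
      rw [hcall a ha, hcall _ (by positivity)]
    rw [measureReal_eq_measureReal_iff] at h_tail
    rw [← Set.compl_Ioi, prob_compl_eq_one_sub measurableSet_Ioi,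
      prob_compl_eq_one_sub measurableSet_Ioi, h_tail]
end

section
/- (Lemma 2 of the paper: the call-pricing and put-pricing measures coincide.) Let μ₁ and μ₂ be Borel probability measures on ℝ with μ₁((-∞,0)) = μ₂((-∞,0)) = 0, where μ₁ has finite first moment, and let F ∈ ℝ. If put-call parity holds at every strike, i.e. for all K ≥ 0, ∫ max(x − K, 0) dμ₁(x) − ∫ max(K − x, 0) dμ₂(x) + K = F, then μ₁ = μ₂. -/
open MeasureTheory

open Filter Topology in
/-- The right difference quotients of the put-price function at `K` converge to the mass of
`(-∞, K]`. -/
theorem tendsto_put_difference_quotient (μ : Measure ℝ) [IsFiniteMeasure μ]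
    (hμ : ∀ K : ℝ, Integrable (fun x : ℝ => max (K - x) 0) μ) (K : ℝ) :
    Tendsto (fun h : ℝ => h⁻¹ * ((∫ x, max (K + h - x) 0 ∂μ) - ∫ x, max (K - x) 0 ∂μ))
      (𝓝[>] 0) (𝓝 (μ.real (Set.Iic K))) := by
  have hlim : Tendsto (fun h : ℝ => ∫ x, h⁻¹ * (max (K + h - x) 0 - max (K - x) 0) ∂μ)
      (𝓝[>] 0) (𝓝 (∫ x, (Set.Iic K).indicator 1 x ∂μ)) := by
    refine tendsto_integral_filter_of_dominated_convergence (fun _ => 1)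
      (Eventually.of_forall fun h => by fun_prop) ?_ (integrable_const 1) ?_
    · filter_upwards [self_mem_nhdsWithin] with h (hh : 0 < h)
      refine Eventually.of_forall fun x => ?_
      rw [norm_mul, norm_inv, Real.norm_eq_abs, Real.norm_eq_abs, abs_of_pos hh,
        inv_mul_le_iff₀ hh, mul_one]
      calc |max (K + h - x) 0 - max (K - x) 0| ≤ |(K + h - x) - (K - x)| :=
            abs_max_sub_max_le_abs _ _ _
        _ = h := by rw [show K + h - x - (K - x) = h by ring, abs_of_pos hh]
    · refine Eventually.of_forall fun x => ?_
      refine tendsto_const_nhds.congr' ?_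
      rcases le_or_gt x K with hx | hx
      · filter_upwards [self_mem_nhdsWithin] with h (hh : 0 < h)
        rw [Set.indicator_of_mem (Set.mem_Iic.2 hx), max_eq_left (by linarith),
          max_eq_left (by linarith), Pi.one_apply]
        field_simp
        ring
      · filter_upwards [Ioo_mem_nhdsGT (sub_pos.2 hx)] with h hh
        rw [Set.indicator_of_notMem (Set.notMem_Iic.2 hx), max_eq_right (by linarith [hh.2]),
          max_eq_right (by linarith), sub_self, mul_zero]
  rw [integral_indicator_one measurableSet_Iic] at hlim
  refine hlim.congr fun h => ?_
  rw [integral_const_mul, integral_sub (hμ _) (hμ _)]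

/-- A finite measure on `ℝ` is determined by its put prices. -/
theorem measure_eq_of_put_eq (μ ν : Measure ℝ) [IsFiniteMeasure μ] [IsFiniteMeasure ν]
    (hμ : ∀ K : ℝ, Integrable (fun x : ℝ => max (K - x) 0) μ)
    (hν : ∀ K : ℝ, Integrable (fun x : ℝ => max (K - x) 0) ν)
    (h : ∀ K : ℝ, ∫ x, max (K - x) 0 ∂μ = ∫ x, max (K - x) 0 ∂ν) : μ = ν := by
  refine Measure.ext_of_Iic μ ν fun K => ?_
  have hK := tendsto_put_difference_quotient μ hμ K
  simp only [h] at hK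
  exact (measureReal_eq_measureReal_iff).1
    (tendsto_nhds_unique hK (tendsto_put_difference_quotient ν hν K))

theorem ae_nonneg_of_measure_Iio_zero {μ : Measure ℝ} (h : μ (Set.Iio 0) = 0) :
    ∀ᵐ x ∂μ, 0 ≤ x := by
  simpa [ae_iff, Set.Iio] using h

theorem integrable_put_of_nonneg {μ : Measure ℝ} [IsFiniteMeasure μ]
    (h : ∀ᵐ x ∂μ, 0 ≤ x) (K : ℝ) : Integrable (fun x : ℝ => max (K - x) 0) μ := by
  refine Integrable.of_bound (by fun_prop) |K| ?_
  filter_upwards [h] with x hx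
  rw [Real.norm_of_nonneg (le_max_right _ _)]
  exact max_le (by linarith [le_abs_self K]) (abs_nonneg K)

theorem put_eq_zero_of_nonpos {μ : Measure ℝ} (h : ∀ᵐ x ∂μ, 0 ≤ x) {K : ℝ} (hK : K ≤ 0) :
    ∫ x, max (K - x) 0 ∂μ = 0 := by
  refine integral_eq_zero_of_ae ?_
  filter_upwards [h] with x hx
  exact max_eq_right (by linarith)

/-- Put-call parity for a single probability measure, with its mean as the forward price. -/
theorem call_eq_put_add_mean_sub {μ : Measure ℝ} [IsProbabilityMeasure μ]
    (hm : Integrable (fun x : ℝ => x) μ) (K : ℝ) :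
    ∫ x, max (x - K) 0 ∂μ = (∫ x, max (K - x) 0 ∂μ) + (∫ x, x ∂μ) - K := by
  have hput : Integrable (fun x : ℝ => max (K - x) 0) μ := ((integrable_const K).sub hm).pos_part
  have hpay (x : ℝ) : max (x - K) 0 = max (K - x) 0 + x - K := by
    rcases le_total x K with hx | hx
    · rw [max_eq_right (by linarith), max_eq_left (by linarith)]
      ring
    · rw [max_eq_left (by linarith), max_eq_right (by linarith)]
      ring
  simp_rw [hpay]
  have hsum : Integrable (fun x : ℝ => max (K - x) 0 + x) μ := hput.add hm
  rw [integral_sub hsum (integrable_const K), integral_add hput hm]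
  simp

/-- Lemma 2 of the paper: if put-call parity holds at every strike between the call
prices under `μ₁` and the put prices under `μ₂`, then `μ₁ = μ₂`. -/
theorem call_put_measures_coincide (μ₁ μ₂ : Measure ℝ)
    [IsProbabilityMeasure μ₁] [IsProbabilityMeasure μ₂]
    (h1 : μ₁ (Set.Iio 0) = 0) (h2 : μ₂ (Set.Iio 0) = 0)
    (hm1 : Integrable (fun x : ℝ => x) μ₁) (F : ℝ)
    (hpar : ∀ K : ℝ, 0 ≤ K →
      (∫ x, max (x - K) 0 ∂μ₁) - (∫ x, max (K - x) 0 ∂μ₂) + K = F) :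
    μ₁ = μ₂ := by
  have hn1 := ae_nonneg_of_measure_Iio_zero h1
  have hn2 := ae_nonneg_of_measure_Iio_zero h2
  refine measure_eq_of_put_eq μ₁ μ₂ (integrable_put_of_nonneg hn1)
    (integrable_put_of_nonneg hn2) fun K => ?_
  rcases le_total K 0 with hK | hK
  · rw [put_eq_zero_of_nonpos hn1 hK, put_eq_zero_of_nonpos hn2 hK]
  · have hparK := hpar K hK
    have hpar0 := hpar 0 le_rfl
    rw [call_eq_put_add_mean_sub hm1] at hparK hpar0
    rw [put_eq_zero_of_nonpos hn1 le_rfl, put_eq_zero_of_nonpos hn2 le_rfl] at hpar0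
    linarith
end

section
/- (Theorem 1 of the paper: unique option pricing measure.) Let c, p : ℝ → ℝ be call and put price functions and F ∈ ℝ a forward price, and suppose put-call parity holds: c(K) − p(K) + K = F for all K ≥ 0. Then there is at most one Borel probability measure μ on ℝ with μ((-∞,0)) = 0 and finite first moment that prices both options by expectation of terminal payoff, i.e. with c(K) = ∫ max(x − K, 0) dμ(x) and p(K) = ∫ max(K − x, 0) dμ(x) for all K ≥ 0; moreover any such μ satisfies ∫ x dμ(x) = F. More precisely: if μ₁, μ₂ are Borel probability measures on ℝ vanishing on (-∞,0) with finite first moment such that c(K) = ∫ max(x − K, 0) dμ₁(x) and p(K) = ∫ max(K − x, 0) dμ₂(x) for all K ≥ 0, then μ₁ = μ₂, and ∫ x dμ₁(x) = F. -/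
open MeasureTheory

/-- The put payoff is integrable under a finite measure with finite first moment. -/
theorem integrable_max_const_sub {μ : Measure ℝ} [IsFiniteMeasure μ]
    (hm : Integrable (fun x : ℝ => x) μ) (K : ℝ) :
    Integrable (fun x => max (K - x) 0) μ :=
  ((integrable_const K).sub hm).pos_part

theorem mul_cdf_le_integral_sub {μ : Measure ℝ} [IsProbabilityMeasure μ]
    (hm : Integrable (fun x : ℝ => x) μ) (a : ℝ) {h : ℝ} (hh : 0 ≤ h) :
    h * ProbabilityTheory.cdf μ a ≤
      (∫ x, max (a + h - x) 0 ∂μ) - ∫ x, max (a - x) 0 ∂μ := by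
  rw [ProbabilityTheory.cdf_eq_real, ← integral_indicator_one measurableSet_Iic,
    ← integral_const_mul,
    ← integral_sub (integrable_max_const_sub hm _) (integrable_max_const_sub hm _)]
  refine integral_mono
    (((integrable_const (1 : ℝ)).indicator measurableSet_Iic).const_mul h)
    ((integrable_max_const_sub hm _).sub (integrable_max_const_sub hm _)) fun x => ?_
  by_cases hx : x ≤ a
  · simp only [Set.indicator, Set.mem_Iic, hx, if_true, Pi.one_apply]
    rw [max_eq_left (by linarith), max_eq_left (by linarith)]
    linarith
  · simp only [Set.indicator, Set.mem_Iic, hx, if_false, mul_zero, sub_nonneg]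
    exact max_le_max (by linarith) le_rfl

theorem integral_sub_le_mul_cdf {μ : Measure ℝ} [IsProbabilityMeasure μ]
    (hm : Integrable (fun x : ℝ => x) μ) (a : ℝ) {h : ℝ} (hh : 0 ≤ h) :
    (∫ x, max (a + h - x) 0 ∂μ) - ∫ x, max (a - x) 0 ∂μ ≤
      h * ProbabilityTheory.cdf μ (a + h) := by
  rw [ProbabilityTheory.cdf_eq_real, ← integral_indicator_one measurableSet_Iic,
    ← integral_const_mul,
    ← integral_sub (integrable_max_const_sub hm _) (integrable_max_const_sub hm _)]
  refine integral_mono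
    ((integrable_max_const_sub hm _).sub (integrable_max_const_sub hm _))
    (((integrable_const (1 : ℝ)).indicator measurableSet_Iic).const_mul h) fun x => ?_
  by_cases hx : x ≤ a + h
  · simp only [Set.indicator, Set.mem_Iic, hx, if_true, Pi.one_apply]
    rw [max_eq_left (by linarith)]
    linarith [le_max_left (a - x) 0]
  · simp only [Set.indicator, Set.mem_Iic, hx, if_false, mul_zero]
    rw [max_eq_right (by linarith), max_eq_right (by linarith), sub_zero]

theorem cdf_le_cdf_of_integral_max_const_sub_eq {μ ν : Measure ℝ}
    [IsProbabilityMeasure μ] [IsProbabilityMeasure ν]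
    (hμ : Integrable (fun x : ℝ => x) μ) (hν : Integrable (fun x : ℝ => x) ν)
    (h : ∀ K : ℝ, ∫ x, max (K - x) 0 ∂μ = ∫ x, max (K - x) 0 ∂ν) (a : ℝ) :
    ProbabilityTheory.cdf μ a ≤ ProbabilityTheory.cdf ν a := by
  refine ge_of_tendsto ((ProbabilityTheory.cdf ν).right_continuous a |>.mono_left
    (nhdsWithin_mono a Set.Ioi_subset_Ici_self)) ?_
  filter_upwards [self_mem_nhdsWithin] with b hb
  have hab : 0 < b - a := sub_pos.2 hb
  have h₁ := mul_cdf_le_integral_sub hμ a hab.le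
  have h₂ := integral_sub_le_mul_cdf hν a hab.le
  rw [h, h] at h₁
  rw [add_sub_cancel] at h₁ h₂
  exact le_of_mul_le_mul_left (h₁.trans h₂) hab

/-- A probability measure with finite first moment is determined by its put prices. -/
theorem eq_of_integral_max_const_sub_eq {μ ν : Measure ℝ}
    [IsProbabilityMeasure μ] [IsProbabilityMeasure ν]
    (hμ : Integrable (fun x : ℝ => x) μ) (hν : Integrable (fun x : ℝ => x) ν)
    (h : ∀ K : ℝ, ∫ x, max (K - x) 0 ∂μ = ∫ x, max (K - x) 0 ∂ν) : μ = ν :=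
  Measure.eq_of_cdf μ ν <| StieltjesFunction.ext fun a =>
    (cdf_le_cdf_of_integral_max_const_sub_eq hμ hν h a).antisymm
      (cdf_le_cdf_of_integral_max_const_sub_eq hν hμ (fun K => (h K).symm) a)

/-- Put-call parity under a single measure. -/
theorem integral_max_sub_const_sub_integral_max_const_sub {μ : Measure ℝ}
    [IsProbabilityMeasure μ] (hm : Integrable (fun x : ℝ => x) μ) (K : ℝ) :
    (∫ x, max (x - K) 0 ∂μ) - ∫ x, max (K - x) 0 ∂μ = (∫ x, x ∂μ) - K := by
  have hcall : Integrable (fun x => max (x - K) 0) μ := (hm.sub (integrable_const K)).pos_part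
  rw [← integral_sub hcall (integrable_max_const_sub hm K)]
  calc ∫ x, (max (x - K) 0 - max (K - x) 0) ∂μ = ∫ x, (x - K) ∂μ := by
        refine integral_congr_ae (.of_forall fun x => ?_)
        simpa only [neg_sub] using max_zero_sub_max_neg_zero_eq_self (x - K)
    _ = (∫ x, x ∂μ) - K := by
        rw [integral_sub hm (integrable_const K)]
        simp

theorem integral_max_const_sub_eq_zero {μ : Measure ℝ} (h : μ (Set.Iio 0) = 0)
    {K : ℝ} (hK : K ≤ 0) : ∫ x, max (K - x) 0 ∂μ = 0 := by
  refine integral_eq_zero_of_ae ?_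
  filter_upwards [measure_eq_zero_iff_ae_notMem.1 h] with x hx
  exact max_eq_right (by linarith [Set.notMem_Iio.1 hx])

/-- Theorem 1 of the paper: given call and put price functions satisfying put-call
parity with forward `F`, there is at most one nonnegative-supported probability
measure with finite first moment pricing them by expectation of terminal payoff, and
any such measure has mean `F`. -/
theorem unique_option_pricing_measure (c p : ℝ → ℝ) (F : ℝ)
    (hpar : ∀ K : ℝ, 0 ≤ K → c K - p K + K = F)
    (μ₁ μ₂ : Measure ℝ) [IsProbabilityMeasure μ₁] [IsProbabilityMeasure μ₂]
    (h1 : μ₁ (Set.Iio 0) = 0) (h2 : μ₂ (Set.Iio 0) = 0)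
    (hm1 : Integrable (fun x : ℝ => x) μ₁) (hm2 : Integrable (fun x : ℝ => x) μ₂)
    (hc : ∀ K : ℝ, 0 ≤ K → c K = ∫ x, max (x - K) 0 ∂μ₁)
    (hp : ∀ K : ℝ, 0 ≤ K → p K = ∫ x, max (K - x) 0 ∂μ₂) :
    μ₁ = μ₂ ∧ (∫ x, x ∂μ₁) = F := by
  have hmean : ∫ x, x ∂μ₁ = F := by
    have h := integral_max_sub_const_sub_integral_max_const_sub hm1 0
    have hF := hpar 0 le_rfl
    rw [hc 0 le_rfl, hp 0 le_rfl, integral_max_const_sub_eq_zero h2 le_rfl] at hF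
    rw [integral_max_const_sub_eq_zero h1 le_rfl] at h
    linarith
  refine ⟨eq_of_integral_max_const_sub_eq hm1 hm2 fun K => ?_, hmean⟩
  rcases le_total 0 K with hK | hK
  · have h := integral_max_sub_const_sub_integral_max_const_sub hm1 K
    have hF := hpar K hK
    rw [hc K hK, hp K hK] at hF
    linarith
  · rw [integral_max_const_sub_eq_zero h1 hK, integral_max_const_sub_eq_zero h2 hK]
end
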